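/- The closure of B₂ in the space H(A₂) equals the standard middle-thirds Cantor set C, and this set C is not a σ-compact subset of H(A₂); moreover the set C \ B₂, with the subspace topology inherited from H(A₂), is homeomorphic to the space of irrational numbers ℝ \ ℚ with its usual (Euclidean) topology. -/

import Mathlib

open Set TopologicalSpace Topology

/-- The Hattori topology τ(A) on ℝ: generated by the Euclidean open sets together with
all sets [x, x+ε) with x ∈ ℝ \ A and ε > 0. -/
def hattori (A : Set ℝ) : TopologicalSpace ℝ :=
  TopologicalSpace.generateFrom
    ({s : Set ℝ | IsOpen s} ∪ {s : Set ℝ | ∃ x ∉ A, ∃ ε > 0, s = Set.Ico x (x + ε)})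

/-- `B₂`: the set of right endpoints of the closed intervals appearing in the standard
middle-thirds construction of the Cantor set. -/
def B2 : Set ℝ :=
  {x | ∃ n : ℕ, ∃ c : ℕ → ℝ, (∀ i, c i = 0 ∨ c i = 2) ∧
    x = (∑ i ∈ Finset.range n, c i / 3 ^ (i + 1)) + 1 / 3 ^ n}

/-- `A₂ = ℝ \ B₂`. -/
def A2 : Set ℝ := B2ᶜ

/-- A topology on a space carrying a digit map and a shift is that of the Baire space, as soon as
points are determined by their digits and a continuous section realises all digit sequences. -/
theorem nonempty_homeomorph_nat_pi_of_coding {X : Type*} [TopologicalSpace X] (ψ : (ℕ → ℕ) → X)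
    (d : X → ℕ) (T : X → X) (hψ : Continuous ψ) (hd : Continuous d) (hT : Continuous T)
    (hdψ : ∀ a, d (ψ a) = a 0) (hTψ : ∀ a, T (ψ a) = ψ (fun n ↦ a (n + 1)))
    (hinj : ∀ x y, (∀ n, d (T^[n] x) = d (T^[n] y)) → x = y) :
    Nonempty (X ≃ₜ (ℕ → ℕ)) := by
  have key : ∀ n a, d (T^[n] (ψ a)) = a n := by
    intro n
    induction n with
    | zero => exact hdψ
    | succ n ih => intro a; rw [Function.iterate_succ_apply, hTψ, ih]
  exact ⟨{
    toFun := fun x n ↦ d (T^[n] x)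
    invFun := ψ
    left_inv := fun x ↦ hinj _ _ fun n ↦ key n _
    right_inv := fun a ↦ funext fun n ↦ key n a
    continuous_toFun := continuous_pi fun n ↦ hd.comp (hT.iterate n)
    continuous_invFun := hψ }⟩

/-- An iterated function system on `[0, 1]` whose two-step compositions are uniformly contracting
has a continuous coding map. -/
theorem exists_continuous_coding (f : ℕ → ℝ → ℝ)
    (hfI : ∀ n, MapsTo (f n) (Icc 0 1) (Icc 0 1)) (hfc : ∀ n, ContinuousOn (f n) (Icc 0 1))
    (hf : ∀ m n, ∀ x ∈ Icc (0 : ℝ) 1, ∀ y ∈ Icc (0 : ℝ) 1,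
      |f m (f n x) - f m (f n y)| ≤ 1 / 4 * |x - y|) :
    ∃ ψ : (ℕ → ℕ) → ℝ, Continuous ψ ∧ (∀ a, ψ a ∈ Icc (0 : ℝ) 1) ∧
      ∀ a, ψ a = f (a 0) (ψ fun n ↦ a (n + 1)) := by
  let F : ℕ → Icc (0 : ℝ) 1 → Icc (0 : ℝ) 1 := fun n ↦ (hfI n).restrict
  have hFc : ∀ n, Continuous (F n) := fun n ↦ (hfc n).mapsToRestrict (hfI n)
  have hFc' : Continuous fun p : ℕ × Icc (0 : ℝ) 1 ↦ F p.1 p.2 :=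
    continuous_prod_of_discrete_left.2 hFc
  let Φ : BoundedContinuousFunction (ℕ → ℕ) (Icc (0 : ℝ) 1) →
      BoundedContinuousFunction (ℕ → ℕ) (Icc (0 : ℝ) 1) := fun g ↦
    BoundedContinuousFunction.mkOfBound
      ⟨fun a ↦ F (a 0) (g fun n ↦ a (n + 1)),
        hFc'.comp (g := fun p : ℕ × Icc (0 : ℝ) 1 ↦ F p.1 p.2)
          (f := fun a : ℕ → ℕ ↦ (a 0, g fun n ↦ a (n + 1))) (by fun_prop)⟩ 1
      fun x y ↦ by
        have := Real.dist_le_of_mem_Icc_01 (F (x 0) (g fun n ↦ x (n + 1))).2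
          (F (y 0) (g fun n ↦ y (n + 1))).2
        exact this
  have hΦ : ∀ g a, Φ g a = F (a 0) (g fun n ↦ a (n + 1)) := fun g a ↦ rfl
  have hcon : ContractingWith (1 / 4) (Φ ∘ Φ) := by
    refine ⟨by norm_num [← NNReal.coe_lt_coe], LipschitzWith.of_dist_le_mul fun g h ↦ ?_⟩
    rw [BoundedContinuousFunction.dist_le (by positivity)]
    intro a
    have h1 := hf (a 0) (a 1) _ (g fun n ↦ a (n + 2)).2 _ (h fun n ↦ a (n + 2)).2
    have h2 := BoundedContinuousFunction.dist_coe_le_dist (f := g) (g := h) fun n ↦ a (n + 2)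
    rw [Subtype.dist_eq, Real.dist_eq] at h2
    simp only [Function.comp_apply, hΦ]
    rw [Subtype.dist_eq, Real.dist_eq]
    refine h1.trans ?_
    push_cast
    gcongr
  have : Nonempty (BoundedContinuousFunction (ℕ → ℕ) (Icc (0 : ℝ) 1)) :=
    ⟨BoundedContinuousFunction.const _ ⟨0, by simp⟩⟩
  let p := hcon.fixedPoint
  have hp : Function.IsFixedPt (Φ ∘ Φ) p := hcon.fixedPoint_isFixedPt
  have hp' : Φ p = p := hcon.fixedPoint_unique' (congrArg Φ hp) hp
  refine ⟨fun a ↦ p a, continuous_subtype_val.comp p.continuous, fun a ↦ (p a).2, fun a ↦ ?_⟩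
  exact congrArg Subtype.val ((DFunLike.congr_fun hp' a).symm.trans (hΦ p a))

/-- A set partitioned into relatively open pieces by the branches of a contracting iterated
function system, and containing all its limit points, is homeomorphic to the Baire space. -/
theorem nonempty_homeomorph_nat_pi_of_ifs {X : Set ℝ} (f g : ℕ → ℝ → ℝ) (V : ℕ → Set ℝ)
    (hX : X ⊆ Icc 0 1)
    (hfI : ∀ n, MapsTo (f n) (Icc 0 1) (Icc 0 1)) (hfc : ∀ n, ContinuousOn (f n) (Icc 0 1))
    (hf : ∀ m n, ∀ x ∈ Icc (0 : ℝ) 1, ∀ y ∈ Icc (0 : ℝ) 1,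
      |f m (f n x) - f m (f n y)| ≤ 1 / 4 * |x - y|)
    (hV : ∀ n, IsOpen (V n)) (hfV : ∀ m n, ∀ x ∈ X, f m x ∈ V n ↔ m = n)
    (hgf : ∀ n, ∀ x ∈ X, g n (f n x) = x) (hgc : ∀ n, ContinuousOn (g n) (V n))
    (hsurj : ∀ x ∈ X, ∃ n, ∃ y ∈ X, f n y = x)
    (hlim : ∀ ψ : (ℕ → ℕ) → ℝ, (∀ a, ψ a ∈ Icc (0 : ℝ) 1) →
      (∀ a, ψ a = f (a 0) (ψ fun n ↦ a (n + 1))) → ∀ a, ψ a ∈ X) :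
    Nonempty (X ≃ₜ (ℕ → ℕ)) := by
  obtain ⟨ψ, hψc, hψI, hψ⟩ := exists_continuous_coding f hfI hfc hf
  have hψX := hlim ψ hψI hψ
  have hs : ∀ x : X, ∃ n, ∃ y : X, f n y = x := fun x ↦ by
    obtain ⟨n, y, hy, h⟩ := hsurj x x.2
    exact ⟨n, ⟨y, hy⟩, h⟩
  choose d T hdT using hs
  have hdV : ∀ (x : X) n, (x : ℝ) ∈ V n ↔ d x = n := fun x n ↦ by
    rw [← hfV (d x) n (T x) (T x).2, hdT]
  have hTg : ∀ x n, d x = n → (T x : ℝ) = g n x := by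
    rintro x _ rfl
    conv_rhs => rw [← hdT x, hgf _ _ (T x).2]
  have hd : Continuous d := continuous_discrete_rng.2 fun n ↦ by
    convert (hV n).preimage (continuous_subtype_val (p := (· ∈ X))) using 1
    ext x
    exact (hdV x n).symm
  have hT : Continuous T := by
    rw [continuous_induced_rng, continuous_iff_continuousAt]
    intro x
    have h1 : ∀ᶠ y in 𝓝 x, d y = d x := by
      have := hd.continuousAt (x := x)
      rw [ContinuousAt, nhds_discrete ℕ, Filter.tendsto_pure] at this
      exact this
    have h2 : ContinuousAt (fun y : X ↦ g (d x) y) x :=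
      ((hgc (d x)).continuousAt ((hV _).mem_nhds ((hdV x _).2 rfl))).comp
        continuous_subtype_val.continuousAt
    exact h2.congr (h1.mono fun y hy ↦ (hTg y _ hy).symm)
  have hdψ : ∀ a, d ⟨ψ a, hψX a⟩ = a 0 := fun a ↦ by
    rw [← hdV]
    change ψ a ∈ _
    rw [hψ a]
    exact (hfV _ _ _ (hψX _)).2 rfl
  refine nonempty_homeomorph_nat_pi_of_coding (fun a ↦ ⟨ψ a, hψX a⟩) d T (hψc.subtype_mk _) hd hT
    hdψ (fun a ↦ Subtype.ext ?_) fun x y hxy ↦ ?_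
  · rw [hTg _ _ (hdψ a)]
    change g (a 0) (ψ a) = _
    conv_lhs => rw [hψ a]
    exact hgf _ _ (hψX _)
  · have key : ∀ n : ℕ, ∀ x y : X, (∀ n, d (T^[n] x) = d (T^[n] y)) →
        |(x : ℝ) - y| ≤ (1 / 4) ^ n := by
      intro n
      induction n with
      | zero => exact fun x y _ ↦ by simpa [Real.dist_eq] using Real.dist_le_of_mem_Icc_01 (hX x.2) (hX y.2)
      | succ n ih =>
        intro x y h
        have h0 : d x = d y := h 0
        have h1 : d (T x) = d (T y) := h 1
        have h2 := ih (T (T x)) (T (T y)) fun n ↦ h (n + 2)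
        have h3 := hf (d x) (d (T x)) _ (hX (T (T x)).2) _ (hX (T (T y)).2)
        rw [hdT, hdT, h1, hdT, h0, hdT] at h3
        rw [pow_succ']
        linarith
    have hlim0 : Filter.Tendsto (fun n : ℕ ↦ (1 / 4 : ℝ) ^ n) Filter.atTop (𝓝 0) :=
      tendsto_pow_atTop_nhds_zero_of_lt_one (by norm_num) (by norm_num)
    have h0 := ge_of_tendsto' hlim0 fun n ↦ key n x y hxy
    exact Subtype.ext (sub_eq_zero.1 (abs_nonpos_iff.1 h0))

/-- Infinite continued fractions are irrational. -/
theorem irrational_of_continuedFraction {ψ : (ℕ → ℕ) → ℝ} (hpos : ∀ a, 0 < ψ a)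
    (hlt : ∀ a, ψ a < 1) (hψ : ∀ a, ψ a = 1 / (a 0 + 1 + ψ fun n ↦ a (n + 1))) (a : ℕ → ℕ) :
    Irrational (ψ a) := by
  have key : ∀ q : ℕ, 0 < q → ∀ (p : ℤ) (a : ℕ → ℕ), ψ a * q ≠ p := by
    intro q
    induction q using Nat.strong_induction_on with
    | _ q ih =>
      intro hq p a h
      have hq' : (0 : ℝ) < q := by exact_mod_cast hq
      have hp : (0 : ℝ) < p := by rw [← h]; exact mul_pos (hpos a) hq'
      have hpq : (p : ℝ) < q := by rw [← h]; exact mul_lt_of_lt_one_left hq' (hlt a)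
      lift p to ℕ using by exact_mod_cast hp.le
      have hs := hpos fun n ↦ a (n + 1)
      refine ih p (by exact_mod_cast hpq) (by exact_mod_cast hp) (q - (a 0 + 1) * p)
        (fun n ↦ a (n + 1)) ?_
      rw [hψ a] at h
      push_cast at h ⊢
      field_simp at h
      linarith
  rintro ⟨r, hr⟩
  refine key r.den r.den_pos r.num a ?_
  rw [← hr]
  exact_mod_cast Rat.mul_den_eq_num r

/-- The irrationals of the unit interval are homeomorphic to the Baire space. -/
theorem nonempty_homeomorph_irrational_Ioo_nat_pi :
    Nonempty ({x : ℝ | Irrational x ∧ x ∈ Ioo (0 : ℝ) 1} ≃ₜ (ℕ → ℕ)) := by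
  refine nonempty_homeomorph_nat_pi_of_ifs (fun n y ↦ 1 / (n + 1 + y)) (fun n x ↦ 1 / x - (n + 1))
    (fun n ↦ Ioo (1 / (n + 2)) (1 / (n + 1))) (fun x hx ↦ Ioo_subset_Icc_self hx.2)
    (fun n y hy ↦ ?_) (fun n ↦ ?_) (fun m n x hx y hy ↦ ?_) (fun n ↦ isOpen_Ioo)
    (fun m n x hx ↦ ?_) (fun n x hx ↦ ?_) (fun n ↦ ?_) (fun x hx ↦ ?_) fun ψ hI hψ ↦ ?_
  · have := hy.1
    have hn : (0 : ℝ) ≤ n := n.cast_nonneg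
    exact ⟨by positivity, by rw [div_le_one (by positivity)]; linarith⟩
  · refine ContinuousOn.div continuousOn_const (by fun_prop) fun y hy ↦ ?_
    have := hy.1
    positivity
  · have hx0 := hx.1
    have hy0 := hy.1
    have e : 1 / ((m : ℝ) + 1 + 1 / (n + 1 + x)) - 1 / ((m : ℝ) + 1 + 1 / (n + 1 + y)) =
        (x - y) / (((m + 1) * (n + 1 + x) + 1) * ((m + 1) * (n + 1 + y) + 1)) := by
      field_simp
      ring
    have hm : (0 : ℝ) ≤ m := m.cast_nonneg
    have hn : (0 : ℝ) ≤ n := n.cast_nonneg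
    have h2 : ∀ z : ℝ, 0 ≤ z → 2 ≤ ((m : ℝ) + 1) * (n + 1 + z) + 1 := fun z hz ↦ by
      nlinarith [mul_nonneg hm hn, mul_nonneg hm hz]
    rw [e, abs_div, abs_of_pos (a := _ * _) (by positivity), div_le_iff₀ (by positivity)]
    nlinarith [mul_le_mul (h2 x hx0) (h2 y hy0) (by norm_num) (by positivity), abs_nonneg (x - y)]
  · obtain ⟨-, h0, h1⟩ := hx
    have hm : (0 : ℝ) ≤ m := m.cast_nonneg
    rw [mem_Ioo, one_div_lt_one_div (by positivity) (by positivity),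
      one_div_lt_one_div (by positivity) (by positivity)]
    refine ⟨fun ⟨h2, h3⟩ ↦ ?_, ?_⟩
    · have h4 : (m : ℝ) < n + 1 := by linarith
      have h5 : (n : ℝ) < m + 1 := by linarith
      norm_cast at h4 h5
      omega
    · rintro rfl
      constructor <;> linarith
  · simp
  · refine (ContinuousOn.div continuousOn_const continuousOn_id fun x hx ↦ ?_).sub
      continuousOn_const
    have : (0 : ℝ) < 1 / (n + 2) := by positivity
    exact (this.trans hx.1).ne'
  · obtain ⟨hi, h0, h1⟩ := hx
    have hx1 : 1 ≤ ⌊x⁻¹⌋₊ := Nat.le_floor (by simpa using (one_lt_inv₀ h0).2 h1 |>.le)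
    have hirr : Irrational (x⁻¹ - ⌊x⁻¹⌋₊) := hi.inv.sub_natCast _
    have hle := Nat.floor_le (inv_pos.2 h0).le
    have hlt := Nat.lt_floor_add_one x⁻¹
    refine ⟨⌊x⁻¹⌋₊ - 1, x⁻¹ - ⌊x⁻¹⌋₊, ⟨hirr, ?_, ?_⟩, ?_⟩
    · exact lt_of_le_of_ne (by linarith) hirr.ne_zero.symm
    · linarith
    · rw [Nat.cast_sub hx1]
      simp
  · have hpos : ∀ a, 0 < ψ a := fun a ↦ by
      have := (hI fun n ↦ a (n + 1)).1
      rw [hψ a]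
      positivity
    have hlt : ∀ a, ψ a < 1 := fun a ↦ by
      have := hpos fun n ↦ a (n + 1)
      have hn : (0 : ℝ) ≤ a 0 := (a 0).cast_nonneg
      rw [hψ a, div_lt_one (by positivity)]
      linarith
    exact fun a ↦ ⟨irrational_of_continuedFraction hpos hlt hψ a, hpos a, hlt a⟩

/-- The irrationals are homeomorphic to the irrationals of the unit interval. -/
theorem nonempty_homeomorph_irrational_irrational_Ioo :
    Nonempty ({x : ℝ | Irrational x} ≃ₜ {x : ℝ | Irrational x ∧ x ∈ Ioo (0 : ℝ) 1}) := by
  let u : ℝ → ℝ := fun x ↦ (1 + x / (1 + |x|)) / 2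
  let v : ℝ → ℝ := fun y ↦ (2 * y - 1) / (1 - |2 * y - 1|)
  have huv : ∀ y ∈ Ioo (0 : ℝ) 1, u (v y) = y := by
    rintro y ⟨h0, h1⟩
    have hz : |2 * y - 1| < 1 := abs_lt.2 ⟨by linarith, by linarith⟩
    have hz' : 0 < 1 - |2 * y - 1| := by linarith
    simp only [u, v, abs_div, abs_of_pos hz']
    field_simp
    ring
  have hpos : ∀ x : ℝ, 0 < 1 + |x| := fun x ↦ by positivity
  have hvu : ∀ x, v (u x) = x := fun x ↦ by
    have h : 2 * u x - 1 = x / (1 + |x|) := by simp only [u]; ring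
    have := hpos x
    simp only [v, h, abs_div, abs_of_pos this]
    field_simp
    simp
  have hu01 : ∀ x, u x ∈ Ioo (0 : ℝ) 1 := fun x ↦ by
    have h1 : -1 < x / (1 + |x|) := by
      rw [lt_div_iff₀ (hpos x)]; linarith [neg_abs_le x]
    have h2 : x / (1 + |x|) < 1 := by
      rw [div_lt_one (hpos x)]; linarith [le_abs_self x]
    constructor <;> simp only [u] <;> linarith
  have hur : ∀ x, Irrational x → Irrational (u x) := by
    rintro x hx ⟨r, hr⟩
    refine hx ⟨(2 * r - 1) / (1 - |2 * r - 1|), ?_⟩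
    rw [← hvu x, ← hr]
    push_cast
    rfl
  have hvr : ∀ y ∈ Ioo (0 : ℝ) 1, Irrational y → Irrational (v y) := by
    rintro y hy hi ⟨r, hr⟩
    refine hi ⟨(1 + r / (1 + |r|)) / 2, ?_⟩
    rw [← huv y hy, ← hr]
    push_cast
    rfl
  have huc : Continuous u := by
    have : Continuous fun x : ℝ ↦ x / (1 + |x|) :=
      continuous_id.div (by fun_prop) fun x ↦ (hpos x).ne'
    fun_prop
  have hvc : ContinuousOn v (Ioo 0 1) := by
    refine ContinuousOn.div (by fun_prop) (by fun_prop) fun y hy ↦ ?_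
    have : |2 * y - 1| < 1 := abs_lt.2 ⟨by linarith [hy.1], by linarith [hy.2]⟩
    linarith
  exact ⟨{
    toFun := fun x ↦ ⟨u x, hur x x.2, hu01 x⟩
    invFun := fun y ↦ ⟨v y, hvr y y.2.2 y.2.1⟩
    left_inv := fun x ↦ Subtype.ext (hvu x)
    right_inv := fun y ↦ Subtype.ext (huv y y.2.2)
    continuous_toFun := (huc.comp continuous_subtype_val).subtype_mk _
    continuous_invFun := (hvc.comp_continuous continuous_subtype_val fun y ↦ y.2.2).subtype_mk _ }⟩

theorem not_isSigmaCompact_univ_nat_pi : ¬ IsSigmaCompact (univ : Set (ℕ → ℕ)) := by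
  rintro ⟨K, hK, hU⟩
  have hb : ∀ n, ∃ N, ∀ a ∈ K n, a n ≤ N := fun n ↦ by
    obtain ⟨N, hN⟩ := ((hK n).image (continuous_apply n)).bddAbove
    exact ⟨N, fun a ha ↦ hN ⟨a, ha, rfl⟩⟩
  choose N hN using hb
  obtain ⟨n, hn⟩ := mem_iUnion.1 (hU.ge (mem_univ fun n ↦ N n + 1))
  exact absurd (hN n _ hn) (by simp)

theorem one_mem_B2 : (1 : ℝ) ∈ B2 := ⟨0, fun _ ↦ 0, by simp⟩

theorem sum_digits_succ (n : ℕ) (c : ℕ → ℝ) :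
    (∑ i ∈ Finset.range (n + 1), c i / 3 ^ (i + 1)) + 1 / 3 ^ (n + 1) =
      (c 0 + ((∑ i ∈ Finset.range n, c (i + 1) / 3 ^ (i + 1)) + 1 / 3 ^ n)) / 3 := by
  rw [Finset.sum_range_succ', add_div, add_div, Finset.sum_div]
  simp only [pow_succ, div_div]
  ring

theorem add_div_three_mem_B2 {x d : ℝ} (hd : d = 0 ∨ d = 2) (hx : x ∈ B2) : (d + x) / 3 ∈ B2 := by
  obtain ⟨n, c, hc, rfl⟩ := hx
  refine ⟨n + 1, fun i ↦ Nat.casesOn i d c, fun i ↦ ?_, ?_⟩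
  · cases i
    exacts [hd, hc _]
  · exact (sum_digits_succ n fun i ↦ Nat.casesOn i d c).symm

theorem div_three_mem_B2 {x : ℝ} (hx : x ∈ B2) : x / 3 ∈ B2 := by
  simpa using add_div_three_mem_B2 (Or.inl rfl) hx

theorem B2_induction {P : ℝ → Prop} (h1 : P 1) (h0 : ∀ x ∈ B2, P x → P (x / 3))
    (h2 : ∀ x ∈ B2, P x → P ((2 + x) / 3)) : ∀ x ∈ B2, P x := by
  rintro _ ⟨n, c, hc, rfl⟩
  induction n generalizing c with
  | zero => simpa using h1
  | succ n ih =>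
    rw [sum_digits_succ]
    have hc' : ∀ i, c (i + 1) = 0 ∨ c (i + 1) = 2 := fun i ↦ hc _
    rcases hc 0 with h | h <;> rw [h]
    · rw [zero_add]
      exact h0 _ ⟨n, _, hc', rfl⟩ (ih _ hc')
    · exact h2 _ ⟨n, _, hc', rfl⟩ (ih _ hc')

theorem mem_cantorSet_cases {x : ℝ} (hx : x ∈ cantorSet) :
    ∃ y ∈ cantorSet, x = y / 3 ∨ x = (2 + y) / 3 := by
  rw [cantorSet_eq_union_halves] at hx
  obtain ⟨y, hy, rfl⟩ | ⟨y, hy, rfl⟩ := hx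
  exacts [⟨y, hy, Or.inl rfl⟩, ⟨y, hy, Or.inr rfl⟩]

theorem div_three_mem_cantorSet {x : ℝ} (hx : x ∈ cantorSet) : x / 3 ∈ cantorSet := by
  rw [cantorSet_eq_union_halves]
  exact Or.inl ⟨x, hx, rfl⟩

theorem two_add_div_three_mem_cantorSet {x : ℝ} (hx : x ∈ cantorSet) :
    (2 + x) / 3 ∈ cantorSet := by
  rw [cantorSet_eq_union_halves]
  exact Or.inr ⟨x, hx, rfl⟩

theorem one_mem_cantorSet : (1 : ℝ) ∈ cantorSet := by
  refine mem_iInter.2 fun n ↦ ?_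
  induction n with
  | zero => simp
  | succ n ih => exact Or.inr ⟨1, ih, by norm_num⟩

theorem B2_subset_cantorSet : B2 ⊆ cantorSet :=
  B2_induction one_mem_cantorSet (fun _ _ ↦ div_three_mem_cantorSet)
    fun _ _ ↦ two_add_div_three_mem_cantorSet

theorem cantorSet_subset_closure_B2 : cantorSet ⊆ closure B2 := by
  have key : ∀ n : ℕ, ∀ x ∈ cantorSet, ∃ b ∈ B2, |x - b| ≤ (1 / 3) ^ n := by
    intro n
    induction n with
    | zero =>
      intro x hx
      exact ⟨1, one_mem_B2, by
        simpa [Real.dist_eq] using Real.dist_le_of_mem_Icc_01 (cantorSet_subset_unitInterval hx) (by simp)⟩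
    | succ n ih =>
      intro x hx
      obtain ⟨y, hy, rfl | rfl⟩ := mem_cantorSet_cases hx <;> obtain ⟨b, hb, h⟩ := ih y hy
      · refine ⟨b / 3, div_three_mem_B2 hb, ?_⟩
        rw [← sub_div, abs_div, abs_of_pos (by norm_num : (0 : ℝ) < 3), pow_succ]
        linarith
      · refine ⟨(2 + b) / 3, add_div_three_mem_B2 (Or.inr rfl) hb, ?_⟩
        rw [← sub_div, add_sub_add_left_eq_sub, abs_div, abs_of_pos (by norm_num : (0 : ℝ) < 3),
          pow_succ]
        linarith
  intro x hx
  refine Metric.mem_closure_iff.2 fun ε hε ↦ ?_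
  obtain ⟨n, hn⟩ := exists_pow_lt_of_lt_one hε (by norm_num : (1 / 3 : ℝ) < 1)
  obtain ⟨b, hb, h⟩ := key n x hx
  exact ⟨b, hb, h.trans_lt hn⟩

/-- Every point of `B2` is isolated from the right in the Cantor set. -/
theorem exists_Ico_inter_cantorSet_subset :
    ∀ b ∈ B2, ∃ ε > 0, ε ≤ 1 ∧ ∀ z ∈ cantorSet, z ∈ Ico b (b + ε) → z = b := by
  refine B2_induction ⟨1, one_pos, le_rfl, fun z hz h ↦ ?_⟩ (fun b hb ⟨ε, h0, h1, h⟩ ↦ ?_)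
    fun b hb ⟨ε, h0, h1, h⟩ ↦ ?_
  · exact le_antisymm (cantorSet_subset_unitInterval hz).2 h.1
  all_goals
    have hb := cantorSet_subset_unitInterval (B2_subset_cantorSet hb)
    refine ⟨ε / 3, by positivity, by linarith, fun z hz hzb ↦ ?_⟩
    obtain ⟨y, hy, rfl | rfl⟩ := mem_cantorSet_cases hz <;>
      have hyI := cantorSet_subset_unitInterval hy
  · rw [h y hy ⟨by linarith [hzb.1], by linarith [hzb.2]⟩]
  · linarith [hzb.2, hb.2, hyI.1]
  · linarith [hzb.1, hb.1, hyI.2]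
  · rw [h y hy ⟨by linarith [hzb.1], by linarith [hzb.2]⟩]

/-- The Cantor set without its right endpoints is homeomorphic to the Baire space. -/
theorem nonempty_homeomorph_cantorSet_diff_B2_nat_pi :
    Nonempty (↥(cantorSet \ B2) ≃ₜ (ℕ → ℕ)) := by
  have hpow : ∀ n : ℕ, 0 < (1 / 3 : ℝ) ^ n ∧ (1 / 3 : ℝ) ^ n ≤ 1 := fun n ↦
    ⟨by positivity, pow_le_one₀ (by norm_num) (by norm_num)⟩
  have hpow_lt : ∀ {m n : ℕ}, m < n → (1 / 3 : ℝ) ^ n ≤ (1 / 3) ^ m / 3 := fun {m n} h ↦ by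
    have := pow_le_pow_of_le_one (by norm_num : (0 : ℝ) ≤ 1 / 3) (by norm_num) (Nat.succ_le_of_lt h)
    rw [pow_succ] at this
    linarith
  have hdiff : ∀ (n : ℕ) (x y : ℝ), |1 - (1 / 3) ^ n + (1 / 3) ^ n * x / 3 -
      (1 - (1 / 3) ^ n + (1 / 3) ^ n * y / 3)| ≤ 1 / 3 * |x - y| := fun n x y ↦ by
    rw [show 1 - (1 / 3) ^ n + (1 / 3) ^ n * x / 3 - (1 - (1 / 3) ^ n + (1 / 3) ^ n * y / 3) =
      (1 / 3) ^ n * (1 / 3 * (x - y)) by ring, abs_mul, abs_mul, abs_of_pos (hpow n).1,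
      abs_of_pos (by norm_num : (0 : ℝ) < 1 / 3)]
    exact mul_le_of_le_one_left (by positivity) (hpow n).2
  refine nonempty_homeomorph_nat_pi_of_ifs
    (fun n y ↦ 1 - (1 / 3) ^ n + (1 / 3) ^ n * y / 3) (fun n x ↦ 3 ^ (n + 1) * (x - 1) + 3)
    (fun n ↦ Ioo (1 - 2 * (1 / 3) ^ n) (1 - (1 / 3) ^ n / 3))
    (fun x hx ↦ cantorSet_subset_unitInterval hx.1)
    (fun n y hy ↦ ?_) (fun n ↦ by fun_prop) (fun m n x hx y hy ↦ ?_) (fun n ↦ isOpen_Ioo)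
    (fun m n x hx ↦ ?_) (fun n x hx ↦ ?_) (fun n ↦ by fun_prop) (fun x hx ↦ ?_) fun ψ hI hψ ↦ ?_
  · obtain ⟨h0, h1⟩ := hpow n
    constructor <;> nlinarith [hy.1, hy.2]
  · have h1 := hdiff m (1 - (1 / 3) ^ n + (1 / 3) ^ n * x / 3)
      (1 - (1 / 3) ^ n + (1 / 3) ^ n * y / 3)
    have h2 := hdiff n x y
    have h3 := abs_nonneg (x - y)
    linarith
  · obtain ⟨h0, h1⟩ := cantorSet_subset_unitInterval hx.1
    have hm := (hpow m).1
    have hmx : 0 ≤ (1 / 3 : ℝ) ^ m * x := by positivity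
    have hmx' : (1 / 3 : ℝ) ^ m * x ≤ (1 / 3) ^ m := mul_le_of_le_one_right hm.le h1
    refine ⟨fun h ↦ ?_, ?_⟩
    · rcases lt_trichotomy m n with hlt | heq | hlt
      · linarith [h.1, hpow_lt hlt]
      · exact heq
      · linarith [h.2, hpow_lt hlt]
    · rintro rfl
      constructor <;> linarith
  · have : (3 : ℝ) ^ n * (1 / 3) ^ n = 1 := by rw [← mul_pow]; norm_num
    rw [pow_succ]
    linear_combination (x - 3) * this
  · have key : ∀ N : ℕ, ∀ x ∈ cantorSet \ B2, x ≤ 1 - (1 / 3) ^ N → ∃ n : ℕ,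
        ∃ y ∈ cantorSet \ B2, 1 - (1 / 3) ^ n + (1 / 3) ^ n * y / 3 = x := by
      intro N
      induction N with
      | zero =>
        rintro x ⟨hx, hxB⟩ hle
        obtain ⟨y, hy, rfl | rfl⟩ := mem_cantorSet_cases hx
        · exact ⟨0, y, ⟨hy, fun h ↦ hxB (div_three_mem_B2 h)⟩, by simp⟩
        · have := (cantorSet_subset_unitInterval hy).1
          norm_num at hle
          linarith
      | succ N ih =>
        rintro x ⟨hx, hxB⟩ hle
        obtain ⟨y, hy, rfl | rfl⟩ := mem_cantorSet_cases hx
        · exact ⟨0, y, ⟨hy, fun h ↦ hxB (div_three_mem_B2 h)⟩, by simp⟩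
        · rw [pow_succ] at hle
          obtain ⟨n, z, hz, h⟩ := ih y ⟨hy, fun h ↦ hxB (add_div_three_mem_B2 (Or.inr rfl) h)⟩
            (by linarith)
          refine ⟨n + 1, z, hz, ?_⟩
          rw [← h, pow_succ]
          ring
    have hx1 : x < 1 := lt_of_le_of_ne (cantorSet_subset_unitInterval hx.1).2
      fun h ↦ hx.2 (h ▸ one_mem_B2)
    obtain ⟨N, hN⟩ := exists_pow_lt_of_lt_one (sub_pos.2 hx1) (by norm_num : (1 / 3 : ℝ) < 1)
    exact key N x hx (by linarith)
  · have hcase : ∀ a, (a 0 = 0 ∧ ψ a = ψ (fun n ↦ a (n + 1)) / 3) ∨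
        ∃ b, ψ a = (2 + ψ b) / 3 := fun a ↦ by
      rcases h : a 0 with _ | k
      · left
        rw [hψ a, h]
        simp
      · right
        refine ⟨fun n ↦ Nat.casesOn n k fun i ↦ a (i + 1), ?_⟩
        have h' : ψ (fun n ↦ Nat.casesOn n k fun i ↦ a (i + 1)) =
          1 - (1 / 3) ^ k + (1 / 3) ^ k * ψ (fun n ↦ a (n + 1)) / 3 := hψ _
        rw [hψ a, h', h, pow_succ]
        ring
    refine fun a ↦ ⟨mem_iInter.2 fun n ↦ ?_, fun hB ↦ ?_⟩
    · induction n generalizing a with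
      | zero => exact hI a
      | succ n ih =>
        rcases hcase a with ⟨-, h⟩ | ⟨b, h⟩ <;> rw [h]
        · exact Or.inl ⟨_, ih _, rfl⟩
        · exact Or.inr ⟨_, ih _, rfl⟩
    · have key : ∀ x ∈ B2, ∀ a, ψ a ≠ x := by
        refine B2_induction (fun a h ↦ ?_) (fun x hx ih a h ↦ ?_) fun x hx ih a h ↦ ?_
        · rw [hψ a] at h
          nlinarith [(hI fun n ↦ a (n + 1)).2, (hpow (a 0)).1]
        all_goals
          have hxI := cantorSet_subset_unitInterval (B2_subset_cantorSet hx)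
          rcases hcase a with ⟨-, h'⟩ | ⟨b, h'⟩
        · exact ih _ (by linarith)
        · linarith [(hI b).1, hxI.2]
        · linarith [(hI fun n ↦ a (n + 1)).2, hxI.1]
        · exact ih _ (by linarith)
      exact key _ hB a rfl

theorem hattori_le (A : Set ℝ) : hattori A ≤ (inferInstance : TopologicalSpace ℝ) :=
  fun _ hs ↦ isOpen_generateFrom_of_mem (Or.inl hs)

/-- At points of `A`, Hattori-open sets are Euclidean neighbourhoods. -/
theorem mem_nhds_of_isOpen_hattori {A U : Set ℝ} (hU : IsOpen[hattori A] U) {x : ℝ} (hx : x ∈ A)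
    (hxU : x ∈ U) : U ∈ 𝓝 x := by
  induction hU with
  | basic s hs =>
    rcases hs with hs | ⟨y, hy, ε, hε, rfl⟩
    · exact IsOpen.mem_nhds hs hxU
    · exact Ico_mem_nhds (lt_of_le_of_ne hxU.1 fun h ↦ hy (h ▸ hx)) hxU.2
  | univ => exact Filter.univ_mem
  | inter s t _ _ ihs iht => exact Filter.inter_mem (ihs hxU.1) (iht hxU.2)
  | sUnion S _ ih =>
    obtain ⟨s, hs, hxs⟩ := hxU
    exact Filter.mem_of_superset (ih s hs hxs) (subset_sUnion_of_mem hs)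

/-- The Hattori topology is Euclidean on subsets of `A`. -/
theorem induced_hattori {A X : Set ℝ} (hX : X ⊆ A) :
    TopologicalSpace.induced ((↑) : X → ℝ) (hattori A) = instTopologicalSpaceSubtype := by
  refine le_antisymm (induced_mono (hattori_le A)) ?_
  rintro s ⟨U, hU, rfl⟩
  refine isOpen_iff_mem_nhds.2 fun x hx ↦ ?_
  exact continuous_subtype_val.continuousAt (mem_nhds_of_isOpen_hattori hU (hX x.2) hx)

theorem closure_hattori_B2 : closure[hattori A2] B2 = cantorSet := by
  refine Subset.antisymm ?_ fun x hx ↦ ?_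
  · exact @closure_minimal _ (hattori A2) _ _ B2_subset_cantorSet
      (isClosed_cantorSet.mono (hattori_le A2))
  · by_cases hxB : x ∈ B2
    · exact @subset_closure _ (hattori A2) _ _ hxB
    · refine (@mem_closure_iff _ (hattori A2) _ _).2 fun U hU hxU ↦ ?_
      exact mem_closure_iff_nhds.1 (cantorSet_subset_closure_B2 hx) U
        (mem_nhds_of_isOpen_hattori hU hxB hxU)

theorem not_isSigmaCompact_hattori_cantorSet : ¬ @IsSigmaCompact ℝ (hattori A2) cantorSet := by
  intro h
  choose! ε hε hε1 hεC using exists_Ico_inter_cantorSet_subset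
  have hopen : IsOpen[hattori A2] (⋃ b ∈ B2, Ico b (b + ε b)) :=
    @isOpen_biUnion _ _ (hattori A2) _ _ fun b hb ↦
      isOpen_generateFrom_of_mem (Or.inr ⟨b, fun h ↦ h hb, ε b, hε b hb, rfl⟩)
  have hdiff : cantorSet \ B2 = cantorSet ∩ (⋃ b ∈ B2, Ico b (b + ε b))ᶜ := by
    ext x
    refine and_congr_right fun hx ↦ not_congr ⟨fun hB ↦ ?_, fun hU ↦ ?_⟩
    · exact mem_biUnion hB ⟨le_rfl, by linarith [hε x hB]⟩
    · obtain ⟨b, hb, hxb⟩ := mem_iUnion₂.1 hU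
      rwa [hεC b hb x hx hxb]
  have hclosed : IsClosed[hattori A2] (cantorSet \ B2) := by
    rw [hdiff]
    exact @IsClosed.inter _ _ _ (hattori A2) (isClosed_cantorSet.mono (hattori_le A2))
      (@isClosed_compl_iff _ (hattori A2) _ |>.2 hopen)
  have h1 : @IsSigmaCompact ℝ (hattori A2) (cantorSet \ B2) :=
    @IsSigmaCompact.of_isClosed_subset _ (hattori A2) _ _ h hclosed sdiff_subset
  have h2 : IsSigmaCompact (cantorSet \ B2) := by
    simpa using @IsSigmaCompact.image _ _ (hattori A2) _ id
      (continuous_id_iff_le.2 (hattori_le A2)) _ h1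
  obtain ⟨e⟩ := nonempty_homeomorph_cantorSet_diff_B2_nat_pi
  refine not_isSigmaCompact_univ_nat_pi ?_
  simpa using (isSigmaCompact_iff_isSigmaCompact_univ.1 h2).image e.continuous

theorem nonempty_homeomorph_cantorSet_diff_B2_irrational :
    Nonempty (↥(cantorSet \ B2) ≃ₜ {x : ℝ | Irrational x}) := by
  obtain ⟨e₁⟩ := nonempty_homeomorph_cantorSet_diff_B2_nat_pi
  obtain ⟨e₂⟩ := nonempty_homeomorph_irrational_Ioo_nat_pi
  obtain ⟨e₃⟩ := nonempty_homeomorph_irrational_irrational_Ioo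
  exact ⟨e₁.trans (e₃.trans e₂).symm⟩

/-- The closure of B₂ in H(A₂) is the Cantor set, which is not a σ-compact subset of
H(A₂); moreover the Cantor set minus B₂, with the subspace topology from H(A₂),
is homeomorphic to the irrationals. -/
theorem closure_B2_eq_cantorSet_not_sigmaCompact :
    closure[hattori A2] B2 = cantorSet ∧
    ¬ @IsSigmaCompact ℝ (hattori A2) cantorSet ∧
    Nonempty (@Homeomorph ↥(cantorSet \ B2) ↥{x : ℝ | Irrational x}
      (TopologicalSpace.induced ((↑) : ↥(cantorSet \ B2) → ℝ) (hattori A2))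
      inferInstance) := by
  refine ⟨closure_hattori_B2, not_isSigmaCompact_hattori_cantorSet, ?_⟩
  rw [induced_hattori (A := A2) (X := cantorSet \ B2) fun x hx ↦ hx.2]
  exact nonempty_homeomorph_cantorSet_diff_B2_irrational
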